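/- arXiv:2101.06417 — 2 statements merged into one kernel-verified Lean document; each statement's English description precedes it below -/
import Mathlib

section
/- Fix K ≥ 1, constants ĉ > 0, M ≥ 0, L ≥ 0 and M₃ ≥ 0. There exists a constant C, depending only on K, ĉ, M, L and M₃, with the following property. For every n ≥ 2, every data set z_1,…,z_n, every index j, and every twice differentiable curve γ̂ : [−1, 0] → ℝ^K satisfying ∇_γ F(γ̂(τ)) + τ·∇_γ h(γ̂(τ), z_j) = 0 for all τ ∈ [−1, 0], if (i) each γ ↦ h(γ, z_i) is ĉ-strongly convex and ∇²f(γ) ⪰ 0 for all γ, (ii) ‖∇_γ h(γ̂(τ), z_j)‖ ≤ M and ‖∇²_γ h(γ̂(τ), z_j)‖ ≤ L for all τ ∈ [−1, 0], and (iii) all third-order partial derivatives in γ of f and of each h(·, z_i) are bounded in absolute value by M₃ at every point γ̂(τ), τ ∈ [−1, 0], then ‖γ̂″(τ)‖ ≤ C/n² for every τ ∈ [−1, 0]. -/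
open Set
open scoped RealInnerProductSpace

noncomputable section

/-- The Hessian of `g` at `γ`, as the (continuous linear) derivative of the gradient field. -/
def hessCLM {K : ℕ} (g : EuclideanSpace ℝ (Fin K) → ℝ) (γ : EuclideanSpace ℝ (Fin K)) :
    EuclideanSpace ℝ (Fin K) →L[ℝ] EuclideanSpace ℝ (Fin K) :=
  fderiv ℝ (gradient g) γ

/-- `g` is `c`-strongly convex: `∇²g(γ) ⪰ c·I` for every `γ`. -/
def StrongConvexHess {K : ℕ} (c : ℝ) (g : EuclideanSpace ℝ (Fin K) → ℝ) : Prop :=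
  ∀ γ v, c * ‖v‖ ^ 2 ≤ ⟪hessCLM g γ v, v⟫

section helpers

variable {K : ℕ}

local notation "E" => EuclideanSpace ℝ (Fin K)

lemma grad_eq (g : E → ℝ) :
    gradient g = fun γ => (InnerProductSpace.toDual ℝ E).symm (fderiv ℝ g γ) := rfl

lemma grad_contDiff {g : E → ℝ} (hg : ContDiff ℝ 3 g) : ContDiff ℝ 2 (gradient g) := by
  rw [grad_eq]
  exact (InnerProductSpace.toDual ℝ E).symm.toContinuousLinearEquiv.contDiff.comp
    (hg.fderiv_right (by norm_num))

lemma hess_contDiff {g : E → ℝ} (hg : ContDiff ℝ 3 g) : ContDiff ℝ 1 (hessCLM g) :=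
  (grad_contDiff hg).fderiv_right (by norm_num)

lemma grad_hasFDerivAt {g : E → ℝ} (hg : ContDiff ℝ 3 g) (x : E) :
    HasFDerivAt (gradient g) (hessCLM g x) x :=
  ((grad_contDiff hg).differentiable (by norm_num) x).hasFDerivAt

lemma hess_hasFDerivAt {g : E → ℝ} (hg : ContDiff ℝ 3 g) (x : E) :
    HasFDerivAt (hessCLM g) (fderiv ℝ (hessCLM g) x) x :=
  ((hess_contDiff hg).differentiable (by norm_num) x).hasFDerivAt

lemma inner_grad (g : E → ℝ) (x w : E) : ⟪gradient g x, w⟫ = fderiv ℝ g x w := by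
  rw [grad_eq]; simp

lemma inner_hess {g : E → ℝ} (hg : ContDiff ℝ 3 g) (x v w : E) :
    ⟪hessCLM g x v, w⟫ = fderiv ℝ (fderiv ℝ g) x v w := by
  have h1 : HasFDerivAt (fun y => ⟪gradient g y, w⟫) _ x :=
    (grad_hasFDerivAt hg x).inner ℝ (hasFDerivAt_const w x)
  have hd : DifferentiableAt ℝ (fderiv ℝ g) x :=
    (hg.fderiv_right (m := 2) (by norm_num)).differentiable (by norm_num) x
  have h2 := hd.hasFDerivAt.clm_apply (hasFDerivAt_const w x)
  simp only [inner_grad] at h1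
  have := DFunLike.congr_fun (h1.unique h2) v
  simpa using this

lemma inner_third {g : E → ℝ} (hg : ContDiff ℝ 3 g) (x u v w : E) :
    ⟪fderiv ℝ (hessCLM g) x u v, w⟫ = iteratedFDeriv ℝ 3 g x ![u, v, w] := by
  have h1 : HasFDerivAt (fun y => ⟪hessCLM g y v, w⟫) _ x :=
    ((hess_hasFDerivAt hg x).clm_apply (hasFDerivAt_const v x)).inner ℝ (hasFDerivAt_const w x)
  have hd : DifferentiableAt ℝ (fderiv ℝ (fderiv ℝ g)) x :=
    ((hg.fderiv_right (m := 2) (by norm_num)).fderiv_right (m := 1)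
      (by norm_num)).differentiable (by norm_num) x
  have h2 := (hd.hasFDerivAt.clm_apply (hasFDerivAt_const v x)).clm_apply (hasFDerivAt_const w x)
  simp only [inner_hess hg] at h1
  have := DFunLike.congr_fun (h1.unique h2) u
  have h3 : iteratedFDeriv ℝ 3 g x ![u, v, w] = fderiv ℝ (fderiv ℝ (fderiv ℝ g)) x u v w := by
    rw [iteratedFDeriv_succ_apply_right, iteratedFDeriv_succ_apply_right,
      iteratedFDeriv_succ_apply_right]
    rfl
  rw [h3]
  simpa using this

lemma trilinear_bound (T : ContinuousMultilinearMap ℝ (fun _ : Fin 3 => E) ℝ) (B : ℝ)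
    (hB : ∀ a b e : Fin K, |T ![EuclideanSpace.single a (1 : ℝ), EuclideanSpace.single b (1 : ℝ),
                EuclideanSpace.single e (1 : ℝ)]| ≤ B) (u v w : E) :
    |T ![u, v, w]| ≤ (K : ℝ) ^ 3 * B * (‖u‖ * ‖v‖ * ‖w‖) := by
  have hx : ∀ y : E, y = ∑ k, y k • EuclideanSpace.single k (1 : ℝ) := by
    intro y
    have := (EuclideanSpace.basisFun (Fin K) ℝ).sum_repr y
    simpa using this.symm
  have e1 : (![u, v, w] : Fin 3 → E)
      = fun i => ∑ k, (![u, v, w] i) k • EuclideanSpace.single k (1 : ℝ) := by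
    funext i; exact hx _
  rw [e1, ContinuousMultilinearMap.map_sum]
  refine (Finset.abs_sum_le_sum_abs _ _).trans ?_
  have : ∀ r ∈ (Finset.univ : Finset (Fin 3 → Fin K)),
      |T (fun i => (![u, v, w] i) (r i) • EuclideanSpace.single (r i) (1 : ℝ))|
        ≤ B * (‖u‖ * ‖v‖ * ‖w‖) := by
    intro r _
    rw [ContinuousMultilinearMap.map_smul_univ]
    have e2 : (fun i => EuclideanSpace.single (r i) (1 : ℝ)) =
      ![EuclideanSpace.single (r 0) (1 : ℝ), EuclideanSpace.single (r 1) (1 : ℝ),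
                EuclideanSpace.single (r 2) (1 : ℝ)] := by
      funext i; fin_cases i <;> rfl
    rw [e2, smul_eq_mul, abs_mul, mul_comm, Fin.prod_univ_three, abs_mul, abs_mul]
    have b1 : |u (r 0)| ≤ ‖u‖ := PiLp.norm_apply_le u (r 0)
    have b2 : |v (r 1)| ≤ ‖v‖ := PiLp.norm_apply_le v (r 1)
    have b3 : |w (r 2)| ≤ ‖w‖ := PiLp.norm_apply_le w (r 2)
    have b4 := hB (r 0) (r 1) (r 2)
    have : 0 ≤ B := (abs_nonneg _).trans b4
    simp only [Matrix.cons_val_zero, Matrix.cons_val_one, Matrix.cons_val]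
    gcongr
  refine (Finset.sum_le_sum this).trans ?_
  simp [mul_assoc]

lemma third_bound {g : E → ℝ} (hg : ContDiff ℝ 3 g) (x : E) (B : ℝ)
    (hB : ∀ a b e : Fin K, |iteratedFDeriv ℝ 3 g x ![EuclideanSpace.single a (1 : ℝ),
      EuclideanSpace.single b (1 : ℝ), EuclideanSpace.single e (1 : ℝ)]| ≤ B) (v : E) :
    ‖fderiv ℝ (hessCLM g) x v v‖ ≤ (K : ℝ) ^ 3 * B * ‖v‖ ^ 2 := by
  set y := fderiv ℝ (hessCLM g) x v v with hy
  have h1 := trilinear_bound _ B hB v v y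
  rw [← inner_third hg, ← hy, real_inner_self_eq_norm_sq, abs_of_nonneg (by positivity)] at h1
  rcases (norm_nonneg y).eq_or_lt with h0 | h0
  · rw [← h0]
    rcases Nat.eq_zero_or_pos K with hK | hK
    · subst hK; simp
    · have : 0 ≤ B := (abs_nonneg _).trans (hB ⟨0, hK⟩ ⟨0, hK⟩ ⟨0, hK⟩)
      positivity
  · nlinarith

lemma coercive {m : ℝ} {H r v : E} (h1 : m * ‖v‖ ^ 2 ≤ ⟪H, v⟫) (h2 : H + r = 0) :
    m * ‖v‖ ≤ ‖r‖ := by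
  have : H = -r := eq_neg_of_add_eq_zero_left h2
  have h3 : ⟪H, v⟫ ≤ ‖r‖ * ‖v‖ := by
    rw [this, ← norm_neg r]; exact real_inner_le_norm _ _
  rcases (norm_nonneg v).eq_or_lt with h0 | h0
  · rw [← h0]; simp
  · by_contra! h4
    nlinarith

lemma first_eq {F g : E → ℝ} (hF : ContDiff ℝ 3 F) (hg : ContDiff ℝ 3 g) {γ γ' : ℝ → E}
    (h1 : ∀ τ ∈ Icc (-1 : ℝ) 0, HasDerivAt γ (γ' τ) τ)
    (he : ∀ τ ∈ Icc (-1 : ℝ) 0, gradient F (γ τ) + τ • gradient g (γ τ) = 0) :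
    ∀ τ ∈ Icc (-1 : ℝ) 0,
      (hessCLM F (γ τ) (γ' τ) + τ • hessCLM g (γ τ) (γ' τ)) + gradient g (γ τ) = 0 := by
  intro τ hτ
  have hu : UniqueDiffWithinAt ℝ (Icc (-1 : ℝ) 0) τ := uniqueDiffOn_Icc (by norm_num) τ hτ
  have a1 := (grad_hasFDerivAt hF (γ τ)).comp_hasDerivAt τ (h1 τ hτ)
  have a2 := (grad_hasFDerivAt hg (γ τ)).comp_hasDerivAt τ (h1 τ hτ)
  have a3 := (a1.add ((hasDerivAt_id τ).smul a2)).hasDerivWithinAt (s := Icc (-1 : ℝ) 0)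
  have a4 : HasDerivWithinAt (fun _ : ℝ => (0 : E)) 0 (Icc (-1 : ℝ) 0) τ :=
    hasDerivWithinAt_const _ _ _
  have a5 := a4.congr (f₁ := fun t => gradient F (γ t) + t • gradient g (γ t))
    (fun t ht => he t ht) (he τ hτ)
  have := hu.eq_deriv _ a3 a5
  rw [← this]; simp [add_assoc]

lemma second_eq {F g : E → ℝ} (hF : ContDiff ℝ 3 F) (hg : ContDiff ℝ 3 g) {γ γ' γ'' : ℝ → E}
    (h1 : ∀ τ ∈ Icc (-1 : ℝ) 0, HasDerivAt γ (γ' τ) τ)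
    (h2 : ∀ τ ∈ Icc (-1 : ℝ) 0, HasDerivAt γ' (γ'' τ) τ)
    (he : ∀ τ ∈ Icc (-1 : ℝ) 0, gradient F (γ τ) + τ • gradient g (γ τ) = 0) :
    ∀ τ ∈ Icc (-1 : ℝ) 0,
      (hessCLM F (γ τ) (γ'' τ) + τ • hessCLM g (γ τ) (γ'' τ)) +
      (fderiv ℝ (hessCLM F) (γ τ) (γ' τ) (γ' τ) + τ • fderiv ℝ (hessCLM g) (γ τ) (γ' τ) (γ' τ)
        + (2 : ℝ) • hessCLM g (γ τ) (γ' τ)) = 0 := by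
  intro τ hτ
  have hu : UniqueDiffWithinAt ℝ (Icc (-1 : ℝ) 0) τ := uniqueDiffOn_Icc (by norm_num) τ hτ
  have a0 := (grad_hasFDerivAt hg (γ τ)).comp_hasDerivAt τ (h1 τ hτ)
  have a1 := ((hess_hasFDerivAt hF (γ τ)).comp_hasDerivAt τ (h1 τ hτ)).clm_apply (h2 τ hτ)
  have a2 := ((hess_hasFDerivAt hg (γ τ)).comp_hasDerivAt τ (h1 τ hτ)).clm_apply (h2 τ hτ)
  have a3 := ((a1.add ((hasDerivAt_id τ).smul a2)).add a0).hasDerivWithinAt (s := Icc (-1 : ℝ) 0)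
  have a4 : HasDerivWithinAt (fun _ : ℝ => (0 : E)) 0 (Icc (-1 : ℝ) 0) τ :=
    hasDerivWithinAt_const _ _ _
  have a5 := a4.congr (fun t ht => first_eq hF hg h1 he t ht) (first_eq hF hg h1 he τ hτ)
  have := hu.eq_deriv _ a3 a5
  rw [← this]
  simp only [Function.comp, id, one_smul, two_smul, smul_add]
  abel

lemma core {F g : E → ℝ} (hF : ContDiff ℝ 3 F) (hg : ContDiff ℝ 3 g) {γ γ' γ'' : ℝ → E}
    (h1 : ∀ τ ∈ Icc (-1 : ℝ) 0, HasDerivAt γ (γ' τ) τ)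
    (h2 : ∀ τ ∈ Icc (-1 : ℝ) 0, HasDerivAt γ' (γ'' τ) τ)
    (he : ∀ τ ∈ Icc (-1 : ℝ) 0, gradient F (γ τ) + τ • gradient g (γ τ) = 0)
    {τ m M L A B : ℝ} (hτ : τ ∈ Icc (-1 : ℝ) 0)
    (hm : ∀ v, m * ‖v‖ ^ 2 ≤ ⟪hessCLM F (γ τ) v + τ • hessCLM g (γ τ) v, v⟫)
    (hM : ‖gradient g (γ τ)‖ ≤ M) (hL : ‖hessCLM g (γ τ)‖ ≤ L)
    (hA : ∀ a b e : Fin K, |iteratedFDeriv ℝ 3 F (γ τ) ![EuclideanSpace.single a (1 : ℝ),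
      EuclideanSpace.single b (1 : ℝ), EuclideanSpace.single e (1 : ℝ)]| ≤ A)
    (hB : ∀ a b e : Fin K, |iteratedFDeriv ℝ 3 g (γ τ) ![EuclideanSpace.single a (1 : ℝ),
      EuclideanSpace.single b (1 : ℝ), EuclideanSpace.single e (1 : ℝ)]| ≤ B) :
    m * ‖γ' τ‖ ≤ M ∧
      m * ‖γ'' τ‖ ≤ (K : ℝ) ^ 3 * (A + B) * ‖γ' τ‖ ^ 2 + 2 * L * ‖γ' τ‖ := by
  refine ⟨(coercive (hm _) (first_eq hF hg h1 he τ hτ)).trans hM, 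
    (coercive (hm _) (second_eq hF hg h1 h2 he τ hτ)).trans ?_⟩
  have hτ' : |τ| ≤ 1 := abs_le.2 ⟨hτ.1, hτ.2.trans (by norm_num)⟩
  have b1 := third_bound hF (γ τ) A hA (γ' τ)
  have b2 := third_bound hg (γ τ) B hB (γ' τ)
  have b3 : ‖hessCLM g (γ τ) (γ' τ)‖ ≤ L * ‖γ' τ‖ := ContinuousLinearMap.le_of_opNorm_le _ hL _
  refine (norm_add₃_le).trans ?_
  rw [norm_smul, norm_smul, Real.norm_eq_abs, Real.norm_two]
  have b4 : |τ| * ‖fderiv ℝ (hessCLM g) (γ τ) (γ' τ) (γ' τ)‖ ≤ 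
      ‖fderiv ℝ (hessCLM g) (γ τ) (γ' τ) (γ' τ)‖ := mul_le_of_le_one_left (norm_nonneg _) hτ'
  linarith

lemma grad_sum {n : ℕ} {h : Fin n → E → ℝ} {f : E → ℝ} (hf : ContDiff ℝ 3 f)
    (hh : ∀ i, ContDiff ℝ 3 (h i)) :
    gradient (fun γ => (∑ i, h i γ) + f γ) = fun γ => (∑ i, gradient (h i) γ) + gradient f γ := by
  funext x
  have a1 : HasFDerivAt (fun γ => (∑ i, h i γ) + f γ) (∑ i, fderiv ℝ (h i) x + fderiv ℝ f x) x :=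
    (HasFDerivAt.fun_sum fun i _ =>
      ((hh i).differentiable (by norm_num) x).hasFDerivAt).add
      (hf.differentiable (by norm_num) x).hasFDerivAt
  simp only [grad_eq, a1.fderiv, map_add, map_sum]

lemma hess_sum {n : ℕ} {h : Fin n → E → ℝ} {f : E → ℝ} (hf : ContDiff ℝ 3 f)
    (hh : ∀ i, ContDiff ℝ 3 (h i)) (x : E) :
    hessCLM (fun γ => (∑ i, h i γ) + f γ) x = (∑ i, hessCLM (h i) x) + hessCLM f x := by
  have a1 : HasFDerivAt (fun γ => (∑ i, gradient (h i) γ) + gradient f γ)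
      ((∑ i, hessCLM (h i) x) + hessCLM f x) x :=
    (HasFDerivAt.fun_sum fun i _ => grad_hasFDerivAt (hh i) x).add (grad_hasFDerivAt hf x)
  rw [← grad_sum hf hh] at a1
  exact a1.fderiv

lemma third_sum {n : ℕ} {h : Fin n → E → ℝ} {f : E → ℝ} (hf : ContDiff ℝ 3 f)
    (hh : ∀ i, ContDiff ℝ 3 (h i)) (x : E) (w : Fin 3 → E) {B : ℝ}
    (hB : ∀ i, |iteratedFDeriv ℝ 3 (h i) x w| ≤ B) (hB' : |iteratedFDeriv ℝ 3 f x w| ≤ B) :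
    |iteratedFDeriv ℝ 3 (fun γ => (∑ i, h i γ) + f γ) x w| ≤ (n + 1) * B := by
  have hs : ContDiff ℝ 3 (fun γ => ∑ i, h i γ) := ContDiff.sum fun i _ => hh i
  have e1 : iteratedFDeriv ℝ 3 (fun γ => (∑ i, h i γ) + f γ) x
      = iteratedFDeriv ℝ 3 (fun γ => ∑ i, h i γ) x + iteratedFDeriv ℝ 3 f x :=
    iteratedFDeriv_add_apply hs.contDiffAt hf.contDiffAt
  have e2 : iteratedFDeriv ℝ 3 (fun γ => ∑ i, h i γ) x = ∑ i, iteratedFDeriv ℝ 3 (h i) x := by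
    have := iteratedFDeriv_sum (𝕜 := ℝ) (i := 3) (f := h) (u := Finset.univ) (fun i _ => hh i)
    rw [this]; simp
  rw [e1, e2]
  simp only [_root_.add_apply, _root_.sum_apply]
  have : |∑ i, iteratedFDeriv ℝ 3 (h i) x w| ≤ n * B := by
    refine (Finset.abs_sum_le_sum_abs _ _).trans ((Finset.sum_le_sum fun i _ => hB i).trans ?_)
    simp
  have := abs_add_le (∑ i, iteratedFDeriv ℝ 3 (h i) x w) (iteratedFDeriv ℝ 3 f x w)
  linarith

lemma coer_sum {n : ℕ} (hn : 2 ≤ n) {h : Fin n → E → ℝ} {f : E → ℝ} (hf : ContDiff ℝ 3 f)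
    (hh : ∀ i, ContDiff ℝ 3 (h i)) (x : E) {c τ : ℝ} (hc : 0 < c) (hτ : τ ∈ Icc (-1 : ℝ) 0)
    (j : Fin n) (hcv : ∀ i, StrongConvexHess c (h i)) (hfv : StrongConvexHess 0 f) (v : E) :
    (c * n / 2) * ‖v‖ ^ 2 ≤
      ⟪hessCLM (fun γ => (∑ i, h i γ) + f γ) x v + τ • hessCLM (h j) x v, v⟫ := by
  rw [hess_sum hf hh]
  simp only [_root_.add_apply, _root_.sum_apply, inner_add_left,
    sum_inner, real_inner_smul_left]
  rw [← Finset.add_sum_erase _ _ (Finset.mem_univ j)]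
  have a1 : ∑ i ∈ Finset.univ.erase j, c * ‖v‖ ^ 2 ≤
      ∑ i ∈ Finset.univ.erase j, ⟪hessCLM (h i) x v, v⟫ :=
    Finset.sum_le_sum fun i _ => hcv i x v
  rw [Finset.sum_const, Finset.card_erase_of_mem (Finset.mem_univ j), Finset.card_univ,
    Fintype.card_fin, nsmul_eq_mul, Nat.cast_sub (by omega), Nat.cast_one] at a1
  have a2 := hcv j x v
  have a3 := hfv x v
  have a4 : 0 ≤ c * ‖v‖ ^ 2 := by positivity
  have a5 : 0 ≤ (1 + τ) * ⟪hessCLM (h j) x v, v⟫ :=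
    mul_nonneg (by linarith [hτ.1]) (a4.trans a2)
  have a6 : (2 : ℝ) ≤ n := by exact_mod_cast hn
  nlinarith

end helpers

/-- For fixed `K ≥ 1`, `ĉ > 0`, `M, L, M₃ ≥ 0` there is a constant `C`
(depending only on these data) such that for every `n ≥ 2`, data set, index `j`, and twice
differentiable curve `γ̂` satisfying `∇F(γ̂(τ)) + τ∇h(γ̂(τ), z_j) = 0` on `[−1,0]`, with
`ĉ`-strongly convex `h(·, zᵢ)`, `∇²f ⪰ 0`, first/second derivative bounds `M`, `L` on
`h(·, z_j)` along the curve, and all third-order partials of `f` and of each `h(·, zᵢ)`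
bounded by `M₃` along the curve, one has `‖γ̂″(τ)‖ ≤ C/n²` on `[−1,0]`. -/
theorem stmt_4 (K : ℕ) (hK : 1 ≤ K) (c M L M₃ : ℝ)
    (hc : 0 < c) (hM : 0 ≤ M) (hL : 0 ≤ L) (hM₃ : 0 ≤ M₃) :
    ∃ C : ℝ, ∀ (Z : Type) (n : ℕ), 2 ≤ n →
      ∀ (z : Fin n → Z) (j : Fin n)
        (h : EuclideanSpace ℝ (Fin K) → Z → ℝ) (f : EuclideanSpace ℝ (Fin K) → ℝ),
        ContDiff ℝ 3 f →
        (∀ i, ContDiff ℝ 3 (fun γ => h γ (z i))) →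
        (∀ i, StrongConvexHess c (fun γ => h γ (z i))) →
        StrongConvexHess 0 f →
        ∀ γhat γhat' γhat'' : ℝ → EuclideanSpace ℝ (Fin K),
        (∀ τ ∈ Icc (-1 : ℝ) 0, HasDerivAt γhat (γhat' τ) τ) →
        (∀ τ ∈ Icc (-1 : ℝ) 0, HasDerivAt γhat' (γhat'' τ) τ) →
        (∀ τ ∈ Icc (-1 : ℝ) 0,
          gradient (fun γ => (∑ i, h γ (z i)) + f γ) (γhat τ)
              + τ • gradient (fun γ => h γ (z j)) (γhat τ) = 0) →
        (∀ τ ∈ Icc (-1 : ℝ) 0, ‖gradient (fun γ => h γ (z j)) (γhat τ)‖ ≤ M) →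
        (∀ τ ∈ Icc (-1 : ℝ) 0, ‖hessCLM (fun γ => h γ (z j)) (γhat τ)‖ ≤ L) →
        (∀ τ ∈ Icc (-1 : ℝ) 0, ∀ a b e : Fin K,
          |iteratedFDeriv ℝ 3 f (γhat τ)
              ![EuclideanSpace.single a (1 : ℝ), EuclideanSpace.single b (1 : ℝ),
                EuclideanSpace.single e (1 : ℝ)]| ≤ M₃) →
        (∀ i, ∀ τ ∈ Icc (-1 : ℝ) 0, ∀ a b e : Fin K,
          |iteratedFDeriv ℝ 3 (fun γ => h γ (z i)) (γhat τ)
              ![EuclideanSpace.single a (1 : ℝ), EuclideanSpace.single b (1 : ℝ),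
                EuclideanSpace.single e (1 : ℝ)]| ≤ M₃) →
        ∀ τ ∈ Icc (-1 : ℝ) 0, ‖γhat'' τ‖ ≤ C / (n : ℝ) ^ 2 := by
  refine ⟨(2 / c) * ((K : ℝ) ^ 3 * (2 * M₃) * (2 * M / c) ^ 2 + 2 * L * (2 * M / c)), ?_⟩
  intro Z n hn z j h f hf hh hcv hfv γ γ' γ'' h1 h2 he hgM hgL hf3 hh3 τ hτ
  have hF : ContDiff ℝ 3 (fun γ => (∑ i, h γ (z i)) + f γ) :=
    (ContDiff.sum fun i _ => hh i).add hf
  have hn' : (2 : ℝ) ≤ n := by exact_mod_cast hn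
  have hn0 : (0 : ℝ) < n := by linarith
  obtain ⟨r1, r2⟩ := core hF (hh j) h1 h2 he hτ
    (coer_sum hn (h := fun i γ => h γ (z i)) hf hh (γ τ) hc hτ j hcv hfv)
    (hgM τ hτ) (hgL τ hτ)
    (fun a b e => third_sum (h := fun i γ => h γ (z i)) hf hh (γ τ) _
      (fun i => hh3 i τ hτ a b e) (hf3 τ hτ a b e)) (hh3 j τ hτ)
  have q1 : ‖γ' τ‖ ≤ (2 * M / c) / n := by
    rw [div_div, le_div_iff₀ (by positivity)]; linarith
  have q2 : (K : ℝ) ^ 3 * ((n + 1) * M₃ + M₃) * ‖γ' τ‖ ^ 2 + 2 * L * ‖γ' τ‖ ≤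
      (K : ℝ) ^ 3 * (n * (2 * M₃)) * ((2 * M / c) / n) ^ 2 + 2 * L * ((2 * M / c) / n) := by
    gcongr
    nlinarith
  have q3 : (K : ℝ) ^ 3 * (n * (2 * M₃)) * ((2 * M / c) / n) ^ 2 + 2 * L * ((2 * M / c) / n)
      = ((K : ℝ) ^ 3 * (2 * M₃) * (2 * M / c) ^ 2 + 2 * L * (2 * M / c)) / n := by
    field_simp
  have q4 := r2.trans (q2.trans q3.le)
  rw [le_div_iff₀ hn0] at q4
  rw [le_div_iff₀ (by positivity)]
  generalize ((K : ℝ) ^ 3 * (2 * M₃) * (2 * M / c) ^ 2 + 2 * L * (2 * M / c)) = R at q4 ⊢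
  rw [div_mul_eq_mul_div, le_div_iff₀ hc]
  nlinarith
end
end

section
/- Let d ≥ 1 and n ≥ 1 be integers and δ ∈ (0,1). Then, with probability at least 1 − δ over an i.i.d. sample S = (z_1, …, z_n) drawn from D^{⊗n}, the following holds simultaneously for all λ = (μ, σ) ∈ ℝ^d × (0,∞)^d and all Δλ = (Δμ, Δσ) ∈ ℝ^d × ℝ^d with σ_k − Δσ_k > 0 for every k: writing q for the diagonal Gaussian measure ⊗_{k=1}^d N(μ_k − Δμ_k, (σ_k − Δσ_k)²) on ℝ^d, one has R(q) ≤ R̂(q, S) + sqrt( (C + 2·log(1/δ) + 2·log n − d + 4) / (4n − 2) ), where C = ‖Δλ‖² + 2·‖λ‖·‖Δλ‖ + ‖λ‖² − 2·Σ_{k=1}^d log(σ_k − Δσ_k) and ‖·‖ is the Euclidean norm on ℝ^{2d}. -/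
open MeasureTheory

noncomputable section

/-- The diagonal Gaussian measure `⊗ₖ N(μ k, (σ k)²)` on `ℝ^d`. -/
def diagGaussian {d : ℕ} (μ σ : Fin d → ℝ) : Measure (Fin d → ℝ) :=
  Measure.pi fun k => ProbabilityTheory.gaussianReal (μ k) (Real.toNNReal ((σ k) ^ 2))

/-- The Euclidean norm of the pair `(μ, σ) ∈ ℝ^{2d}`. -/
def pairNorm {d : ℕ} (μ σ : Fin d → ℝ) : ℝ :=
  Real.sqrt ((∑ k, (μ k) ^ 2) + ∑ k, (σ k) ^ 2)

/-- The expected risk `R(Q) = ∫∫ ℓ(θ, z) dD(z) dQ(θ)`. -/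
def expRisk {d : ℕ} {Z : Type*} [MeasurableSpace Z] (D : Measure Z)
    (ℓ : (Fin d → ℝ) → Z → ℝ) (Q : Measure (Fin d → ℝ)) : ℝ :=
  ∫ θ, ∫ z, ℓ θ z ∂D ∂Q

/-- The empirical risk `R̂(Q, S) = ∫ (1/n) Σᵢ ℓ(θ, zᵢ) dQ(θ)`. -/
def empRisk {d : ℕ} {Z : Type*} [MeasurableSpace Z]
    (ℓ : (Fin d → ℝ) → Z → ℝ) (Q : Measure (Fin d → ℝ)) {n : ℕ} (S : Fin n → Z) : ℝ :=
  ∫ θ, (1 / (n : ℝ)) * ∑ i, ℓ θ (S i) ∂Q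

open ProbabilityTheory Real in
lemma aux_lint_gauss (b : ℝ) (hb : b < 1 / 2) :
    ∫⁻ x, ENNReal.ofReal (Real.exp (b * x ^ 2)) ∂(gaussianReal 0 1)
      = ENNReal.ofReal (Real.sqrt (1 / (1 - 2 * b))) := by
  rw [gaussianReal_of_var_ne_zero 0 one_ne_zero,
    lintegral_withDensity_eq_lintegral_mul _ (measurable_gaussianPDF _ _) (by fun_prop)]
  have h1 : ∀ x : ℝ, (gaussianPDF 0 1 * fun x => ENNReal.ofReal (Real.exp (b * x ^ 2))) x
      = ENNReal.ofReal ((√(2 * π))⁻¹ * Real.exp (-(1 / 2 - b) * x ^ 2)) := by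
    intro x
    simp only [Pi.mul_apply, gaussianPDF, gaussianPDFReal]
    rw [← ENNReal.ofReal_mul (by positivity), mul_assoc, ← Real.exp_add]
    congr 3
    · simp
    · simp; ring
  simp_rw [h1]
  rw [← ofReal_integral_eq_lintegral_ofReal]
  · rw [integral_const_mul, integral_gaussian, ← Real.sqrt_inv, ← Real.sqrt_mul (by positivity)]
    congr 2
    have : (1 / 2 - b) ≠ 0 := by linarith
    have : (1 - 2 * b) ≠ 0 := by linarith
    field_simp
  · exact (integrable_exp_neg_mul_sq (by linarith)).const_mul _
  · exact Filter.Eventually.of_forall fun x => by positivity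

open ProbabilityTheory Real in
lemma aux_exp_sq {Ω : Type*} [MeasurableSpace Ω] (P : Measure Ω) [IsProbabilityMeasure P]
    (Y : Ω → ℝ) (hY : Measurable Y) (c : NNReal) (h : HasSubgaussianMGF Y c P) (a : ℝ)
    (ha : 0 ≤ a) (hac : a * c < 1 / 2) :
    ∫⁻ ω, ENNReal.ofReal (Real.exp (a * (Y ω) ^ 2)) ∂P
      ≤ ENNReal.ofReal (Real.sqrt (1 / (1 - 2 * (a * c)))) := by
  have h1 : ∀ ω, ENNReal.ofReal (Real.exp (a * (Y ω) ^ 2))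
      = ∫⁻ x, ENNReal.ofReal (Real.exp ((√(2 * a) * Y ω) * x)) ∂(gaussianReal 0 1) := by
    intro ω
    rw [← ofReal_integral_eq_lintegral_ofReal (integrable_exp_mul_gaussianReal _)
      (Filter.Eventually.of_forall fun x => by positivity)]
    congr 1
    have := congrFun (mgf_fun_id_gaussianReal (μ := 0) (v := 1)) (√(2 * a) * Y ω)
    rw [mgf] at this
    rw [this, mul_pow, Real.sq_sqrt (by positivity)]
    congr 1
    push_cast; ring
  simp_rw [h1]
  rw [lintegral_lintegral_swap (by fun_prop), ← aux_lint_gauss _ hac]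
  apply lintegral_mono
  intro x
  have h2 : ∀ ω, √(2 * a) * Y ω * x = (√(2 * a) * x) * Y ω := fun ω => by ring
  simp only [h2]
  rw [← ofReal_integral_eq_lintegral_ofReal (h.integrable_exp_mul _)
      (Filter.Eventually.of_forall fun x => by positivity)]
  apply ENNReal.ofReal_le_ofReal
  refine (h.mgf_le _).trans ?_
  rw [mul_pow, Real.sq_sqrt (by positivity)]
  apply le_of_eq
  congr 1
  ring

open ProbabilityTheory in
lemma aux_pi_withDensity {d : ℕ} (Q : Fin d → Measure ℝ) [∀ i, IsProbabilityMeasure (Q i)]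
    (f : Fin d → ℝ → ENNReal) (hf : ∀ i, Measurable (f i))
    [∀ i, IsProbabilityMeasure ((Q i).withDensity (f i))] :
    Measure.pi (fun i => (Q i).withDensity (f i))
      = (Measure.pi Q).withDensity (fun x => ∏ i, f i (x i)) := by
  apply Measure.pi_eq
  intro s hs
  rw [withDensity_apply _ (MeasurableSet.univ_pi hs),
    ← lintegral_indicator (MeasurableSet.univ_pi hs)]
  have h1 : ∀ x : Fin d → ℝ, (Set.univ.pi s).indicator (fun x => ∏ i, f i (x i)) x
      = ∏ i, (s i).indicator (f i) (x i) := by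
    intro x
    by_cases hx : x ∈ Set.univ.pi s
    · rw [Set.indicator_of_mem hx]
      refine Finset.prod_congr rfl fun i _ => ?_
      rw [Set.indicator_of_mem (hx i (Set.mem_univ i))]
    · rw [Set.indicator_of_notMem hx]
      simp only [Set.mem_pi, Set.mem_univ, true_implies, not_forall] at hx
      obtain ⟨i, hi⟩ := hx
      symm
      exact Finset.prod_eq_zero (Finset.mem_univ i) (Set.indicator_of_notMem hi _)
  simp_rw [h1]
  have hm : ∀ i, Measurable ((s i).indicator (f i)) := fun i => (hf i).indicator (hs i)
  have hind := iIndepFun_pi (μ := Q) (X := fun i => (s i).indicator (f i))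
    (fun i => (hm i).aemeasurable)
  have := lintegral_prod_eq_prod_lintegral_of_indepFun (Finset.univ)
    (fun i (x : Fin d → ℝ) => (s i).indicator (f i) (x i)) hind
    (fun i => (hm i).comp (measurable_pi_apply i))
  rw [this]
  refine Finset.prod_congr rfl fun i _ => ?_
  rw [withDensity_apply _ (hs i), ← lintegral_indicator (hs i)]
  rw [← (measurePreserving_eval Q i).map_eq, lintegral_map (hm i) (measurable_pi_apply i)]

open ProbabilityTheory in
lemma aux_gauss_density (m s : ℝ) (hs : 0 < s) :
    gaussianReal 0 1 = (gaussianReal m (Real.toNNReal (s ^ 2))).withDensity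
      (fun x => ENNReal.ofReal (Real.exp (Real.log s + (x - m) ^ 2 / (2 * s ^ 2) - x ^ 2 / 2))) := by
  have hv : Real.toNNReal (s ^ 2) ≠ 0 := by
    simp; positivity
  rw [gaussianReal_of_var_ne_zero 0 one_ne_zero, gaussianReal_of_var_ne_zero m hv,
    ← withDensity_mul _ (measurable_gaussianPDF _ _) (by fun_prop)]
  congr 1
  ext x
  simp only [Pi.mul_apply, gaussianPDF, gaussianPDFReal]
  rw [← ENNReal.ofReal_mul (by positivity)]
  congr 1
  rw [Real.coe_toNNReal _ (by positivity)]
  have e : Real.exp (Real.log s + (x - m) ^ 2 / (2 * s ^ 2) - x ^ 2 / 2)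
    = s * (Real.exp ((x - m) ^ 2 / (2 * s ^ 2)) * Real.exp (- (x ^ 2 / 2))) := by
    rw [sub_eq_add_neg, Real.exp_add, Real.exp_add, Real.exp_log hs, mul_assoc]
  rw [e, Real.sqrt_mul (by positivity) (s ^ 2), Real.sqrt_sq hs.le]
  have e2 : Real.exp (-(x - m) ^ 2 / (2 * s ^ 2)) * Real.exp ((x - m) ^ 2 / (2 * s ^ 2)) = 1 := by
    rw [← Real.exp_add, neg_div, neg_add_cancel, Real.exp_zero]
  have e3 : Real.exp (-(x - 0) ^ 2 / (2 * (1 : NNReal))) = Real.exp (- (x ^ 2 / 2)) := by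
    congr 1; simp; ring
  rw [e3]
  simp only [NNReal.coe_one, mul_one]
  rw [mul_inv]
  calc _ = (√(2 * Real.pi))⁻¹ * (s⁻¹ * s) * Real.exp (-(x ^ 2 / 2)) * 1 := by
        rw [inv_mul_cancel₀ hs.ne']; ring
    _ = _ := by rw [← e2]; ring

open ProbabilityTheory in
lemma aux_moment (m : ℝ) (v : NNReal) (a : ℝ) :
    Integrable (fun x => (x - a) ^ 2) (gaussianReal m v) ∧
    ∫ x, (x - a) ^ 2 ∂(gaussianReal m v) = v + (m - a) ^ 2 := by
  have h2 : MemLp (fun x : ℝ => x) 2 (gaussianReal m v) := memLp_id_gaussianReal 2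
  have h3 : MemLp (fun x : ℝ => x - a) 2 (gaussianReal m v) := h2.sub (memLp_const a)
  refine ⟨h3.integrable_sq, ?_⟩
  have hvar := variance_eq_sub h3
  have : Var[fun x => x - a; gaussianReal m v] = v := by
    rw [variance_sub_const (by fun_prop)]
    exact variance_fun_id_gaussianReal
  have hm : ∫ x, (x - a) ∂(gaussianReal m v) = m - a := by
    rw [integral_sub (h2.integrable (by norm_num)) (integrable_const a), integral_id_gaussianReal]
    simp
  rw [this, hm] at hvar
  simp only [Pi.pow_apply] at hvar
  linarith

lemma aux_norm {d : ℕ} (μ σ Δμ Δσ : Fin d → ℝ) :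
    (∑ k, (μ k - Δμ k) ^ 2) + ∑ k, (σ k - Δσ k) ^ 2 ≤
      (pairNorm Δμ Δσ) ^ 2 + 2 * pairNorm μ σ * pairNorm Δμ Δσ + (pairNorm μ σ) ^ 2 := by
  have h := Real.sum_mul_le_sqrt_mul_sqrt (Finset.univ : Finset (Fin d ⊕ Fin d))
    (Sum.elim μ σ) (Sum.elim (fun k => - Δμ k) (fun k => - Δσ k))
  simp only [Fintype.sum_sum_type, Sum.elim_inl, Sum.elim_inr, neg_sq] at h
  have e1 : (pairNorm Δμ Δσ) ^ 2 = (∑ k, (Δμ k) ^ 2) + ∑ k, (Δσ k) ^ 2 :=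
    Real.sq_sqrt (by positivity)
  have e2 : (pairNorm μ σ) ^ 2 = (∑ k, (μ k) ^ 2) + ∑ k, (σ k) ^ 2 :=
    Real.sq_sqrt (by positivity)
  change _ ≤ pairNorm μ σ * pairNorm Δμ Δσ at h
  have e3 : ∀ a b : Fin d → ℝ, ∑ k, (a k - b k) ^ 2
      = ∑ k, (a k) ^ 2 + ∑ k, (b k) ^ 2 + 2 * ∑ k, a k * - b k := by
    intro a b
    rw [Finset.mul_sum, ← Finset.sum_add_distrib, ← Finset.sum_add_distrib]
    exact Finset.sum_congr rfl fun k _ => by ring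
  rw [e1, e2, e3, e3]
  linarith

lemma aux_dv {E : Type*} [MeasurableSpace E] (P Q : Measure E) [IsProbabilityMeasure Q]
    (w f : E → ℝ) (hw : Measurable w) (hf : Measurable f)
    (hP : P = Q.withDensity (fun x => ENNReal.ofReal (Real.exp (w x))))
    (hwi : Integrable w Q) (hfi : Integrable f Q) (c : ℝ) (hc : 0 < c)
    (h : ∫⁻ x, ENNReal.ofReal (Real.exp (f x)) ∂P ≤ ENNReal.ofReal c) :
    ∫ x, f x ∂Q ≤ - ∫ x, w x ∂Q + Real.log c := by
  rw [hP, lintegral_withDensity_eq_lintegral_mul _ (by fun_prop) (by fun_prop)] at h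
  have e : ∀ x, ((fun x => ENNReal.ofReal (Real.exp (w x))) *
      fun x => ENNReal.ofReal (Real.exp (f x))) x = ENNReal.ofReal (Real.exp (w x + f x)) := by
    intro x
    simp only [Pi.mul_apply]
    rw [← ENNReal.ofReal_mul (by positivity), Real.exp_add]
  simp_rw [e] at h
  have hi : Integrable (fun x => Real.exp (w x + f x)) Q := by
    refine ⟨by fun_prop, ?_⟩
    rw [hasFiniteIntegral_iff_ofReal (Filter.Eventually.of_forall fun x => by positivity)]
    exact h.trans_lt ENNReal.ofReal_lt_top
  rw [← ofReal_integral_eq_lintegral_ofReal hi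
    (Filter.Eventually.of_forall fun x => by positivity), ENNReal.ofReal_le_ofReal_iff hc.le] at h
  have hj := convexOn_exp.map_integral_le (μ := Q) (f := fun x => w x + f x)
    Real.continuous_exp.continuousOn isClosed_univ
    (Filter.Eventually.of_forall fun x => Set.mem_univ _) (hwi.add hfi) hi
  rw [integral_add hwi hfi] at hj
  have := (Real.le_log_iff_exp_le hc).2 (hj.trans h)
  linarith

open ProbabilityTheory in
lemma aux_diag {d : ℕ} (m s : Fin d → ℝ) (hs : ∀ k, 0 < s k) :
    ∃ w : (Fin d → ℝ) → ℝ, Measurable w ∧ Integrable w (diagGaussian m s) ∧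
      (Measure.pi fun _ : Fin d => gaussianReal 0 1)
        = (diagGaussian m s).withDensity (fun x => ENNReal.ofReal (Real.exp (w x))) ∧
      - ∫ x, w x ∂(diagGaussian m s)
        = (∑ k, (m k) ^ 2 + ∑ k, (s k) ^ 2 - 2 * ∑ k, Real.log (s k) - d) / 2 := by
  let u : Fin d → ℝ → ℝ := fun k x =>
    Real.log (s k) + (x - m k) ^ 2 / (2 * s k ^ 2) - x ^ 2 / 2
  have hum : ∀ k, Measurable (u k) := fun k => by fun_prop
  have hu : ∀ k, Integrable (u k) (gaussianReal (m k) (Real.toNNReal ((s k) ^ 2))) ∧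
      ∫ x, u k x ∂(gaussianReal (m k) (Real.toNNReal ((s k) ^ 2)))
        = Real.log (s k) + 1 / 2 - ((s k) ^ 2 + (m k) ^ 2) / 2 := by
    intro k
    obtain ⟨h1, h1'⟩ := aux_moment (m k) (Real.toNNReal ((s k) ^ 2)) (m k)
    obtain ⟨h2, h2'⟩ := aux_moment (m k) (Real.toNNReal ((s k) ^ 2)) 0
    simp only [sub_zero, sub_self] at h1' h2 h2'
    rw [Real.coe_toNNReal _ (by positivity)] at h1' h2'
    have i1 : Integrable (fun x => Real.log (s k) + (x - m k) ^ 2 / (2 * s k ^ 2))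
        (gaussianReal (m k) (Real.toNNReal ((s k) ^ 2))) :=
      (integrable_const _).add (h1.div_const _)
    refine ⟨i1.sub (h2.div_const _), ?_⟩
    simp only [u]
    rw [integral_sub i1 (h2.div_const _), integral_add (integrable_const _) (h1.div_const _),
      integral_div, integral_div, h1', h2']
    have := (hs k).ne'
    simp
    field_simp
  have hi : ∀ k, Integrable (fun x : Fin d → ℝ => u k (x k)) (diagGaussian m s) :=
    fun k => integrable_comp_eval (hu k).1
  refine ⟨fun x => ∑ k, u k (x k), by fun_prop, integrable_finsetSum _ fun k _ => hi k, ?_, ?_⟩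
  · have e := fun k => aux_gauss_density (m k) (s k) (hs k)
    have hp : ∀ k, IsProbabilityMeasure ((gaussianReal (m k) (Real.toNNReal ((s k) ^ 2))).withDensity
        (fun x => ENNReal.ofReal (Real.exp (u k x)))) := by
      intro k
      rw [← e k]
      infer_instance
    have := aux_pi_withDensity (fun k => gaussianReal (m k) (Real.toNNReal ((s k) ^ 2)))
      (fun k x => ENNReal.ofReal (Real.exp (u k x))) (fun k => by fun_prop)
    have e' : (Measure.pi fun _ : Fin d => gaussianReal 0 1) = Measure.pi fun k =>
        (gaussianReal (m k) (Real.toNNReal ((s k) ^ 2))).withDensity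
        (fun x => ENNReal.ofReal (Real.exp (u k x))) := by
      congr 1
      funext k
      exact e k
    rw [e', this]
    unfold diagGaussian
    congr 1
    funext x
    rw [Real.exp_sum, ENNReal.ofReal_prod_of_nonneg (fun i _ => by positivity)]
  · rw [integral_finsetSum _ fun k _ => hi k]
    have : ∀ k, ∫ x, u k (x k) ∂(diagGaussian m s)
        = Real.log (s k) + 1 / 2 - ((s k) ^ 2 + (m k) ^ 2) / 2 := by
      intro k
      rw [← (hu k).2]
      exact integral_comp_eval (μ := fun k => gaussianReal (m k) (Real.toNNReal ((s k) ^ 2)))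
        (hum k).aestronglyMeasurable
    simp_rw [this]
    rw [Finset.sum_sub_distrib, Finset.sum_add_distrib, ← Finset.sum_div, ← Finset.sum_div,
      Finset.sum_add_distrib]
    simp
    ring

open ProbabilityTheory in
lemma aux_mgf {n : ℕ} (hn : 1 ≤ n) {Z : Type*} [MeasurableSpace Z] (D : Measure Z)
    [IsProbabilityMeasure D] (L : Z → ℝ) (hL : Measurable L) (hL' : ∀ z, L z ∈ Set.Icc (0 : ℝ) 1) :
    ∫⁻ S, ENNReal.ofReal (Real.exp ((2 * n - 1) *
        ((∫ z, L z ∂D) - (1 / (n : ℝ)) * ∑ i, L (S i)) ^ 2)) ∂(Measure.pi fun _ : Fin n => D)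
      ≤ ENNReal.ofReal (2 * n) := by
  have hn' : (1 : ℝ) ≤ n := by exact_mod_cast hn
  have hs : HasSubgaussianMGF (fun z => L z - ∫ z, L z ∂D) ((‖(1 : ℝ) - 0‖₊ / 2) ^ 2) D :=
    hasSubgaussianMGF_of_mem_Icc hL.aemeasurable (Filter.Eventually.of_forall hL')
  have hm : Measurable (fun z => L z - ∫ z, L z ∂D) := by fun_prop
  have hind := iIndepFun_pi (μ := fun _ : Fin n => D)
    (X := fun _ => fun z => L z - ∫ z, L z ∂D) (fun _ => hm.aemeasurable)
  have hi : ∀ i : Fin n, HasSubgaussianMGF (fun S : Fin n → Z => L (S i) - ∫ z, L z ∂D)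
      ((‖(1 : ℝ) - 0‖₊ / 2) ^ 2) (Measure.pi fun _ : Fin n => D) := by
    intro i
    have hmap := (measurePreserving_eval (fun _ : Fin n => D) i).map_eq
    have hs' := hs
    generalize (∫ z, L z ∂D) = M at hs' ⊢
    rw [← hmap] at hs'
    have hmi : AEMeasurable (Function.eval i) (Measure.pi fun _ : Fin n => D) :=
      (measurable_pi_apply i).aemeasurable
    exact HasSubgaussianMGF.of_map hmi hs'
  have hsum := HasSubgaussianMGF.sum_of_iIndepFun hind (s := Finset.univ) (fun i _ => hi i)
  have hcc : (((∑ _i : Fin n, (‖(1 : ℝ) - 0‖₊ / 2) ^ 2 : NNReal)) : ℝ) = n / 4 := by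
    simp; ring
  have key := aux_exp_sq _ _ (by fun_prop) _ hsum ((2 * n - 1) / n ^ 2)
    (div_nonneg (by linarith) (by positivity)) (by
      rw [hcc]
      rw [div_mul_div_comm, div_lt_div_iff₀ (by positivity) (by positivity)]
      nlinarith)
  rw [hcc] at key
  refine (le_of_eq ?_).trans (key.trans ?_)
  · refine lintegral_congr fun S => ?_
    congr 2
    rw [Finset.sum_sub_distrib]
    simp
    field_simp
    ring
  · apply ENNReal.ofReal_le_ofReal
    have : 1 / (1 - 2 * ((2 * (n : ℝ) - 1) / n ^ 2 * (n / 4))) = 2 * n := by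
      have : 1 - 2 * ((2 * (n : ℝ) - 1) / n ^ 2 * (n / 4)) = 1 / (2 * n) := by
        field_simp; ring
      rw [this]; simp
    rw [this]
    rw [Real.sqrt_le_left (by linarith)]
    nlinarith

/-- PAC-Bayesian generalization bound for processed mean-field Gaussian
variational distributions: with probability at least `1 − δ` over an i.i.d. sample
`S ~ D^⊗n`, simultaneously for all `λ = (μ, σ)` and updates `Δλ = (Δμ, Δσ)` with
`σₖ > 0` and `σₖ − Δσₖ > 0`, writing `q = ⊗ₖ N(μₖ − Δμₖ, (σₖ − Δσₖ)²)`,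
`R(q) ≤ R̂(q, S) + sqrt((C + 2 log(1/δ) + 2 log n − d + 4)/(4n − 2))`, where
`C = ‖Δλ‖² + 2‖λ‖‖Δλ‖ + ‖λ‖² − 2 Σₖ log(σₖ − Δσₖ)`. -/
theorem stmt_12 (d n : ℕ) (hd : 1 ≤ d) (hn : 1 ≤ n) (δ : ℝ) (hδ : δ ∈ Set.Ioo (0 : ℝ) 1)
    {Z : Type*} [MeasurableSpace Z] (D : Measure Z) [IsProbabilityMeasure D]
    (ℓ : (Fin d → ℝ) → Z → ℝ) (hmeas : Measurable (Function.uncurry ℓ))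
    (hℓ : ∀ θ z, ℓ θ z ∈ Set.Icc (0 : ℝ) 1) :
    1 - ENNReal.ofReal δ ≤
      (Measure.pi fun _ : Fin n => D)
        {S : Fin n → Z |
          ∀ μ σ Δμ Δσ : Fin d → ℝ, (∀ k, 0 < σ k) → (∀ k, 0 < σ k - Δσ k) →
            expRisk D ℓ (diagGaussian (fun k => μ k - Δμ k) (fun k => σ k - Δσ k))
              ≤ empRisk ℓ (diagGaussian (fun k => μ k - Δμ k) (fun k => σ k - Δσ k)) S
                + Real.sqrt
                    (((pairNorm Δμ Δσ) ^ 2 + 2 * pairNorm μ σ * pairNorm Δμ Δσ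
                        + (pairNorm μ σ) ^ 2 - 2 * ∑ k, Real.log (σ k - Δσ k)
                        + 2 * Real.log (1 / δ) + 2 * Real.log (n : ℝ) - (d : ℝ) + 4)
                      / (4 * (n : ℝ) - 2))} := by
  classical
  obtain ⟨hδ0, hδ1⟩ := hδ
  have hn' : (1 : ℝ) ≤ n := by exact_mod_cast hn
  set P : Measure (Fin d → ℝ) := Measure.pi fun _ : Fin d => ProbabilityTheory.gaussianReal 0 1
    with hPdef
  let r : (Fin d → ℝ) → ℝ := fun θ => ∫ z, ℓ θ z ∂D
  let e : (Fin d → ℝ) → (Fin n → Z) → ℝ := fun θ S => (1 / (n : ℝ)) * ∑ i, ℓ θ (S i)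
  have hr : Measurable r := by
    have := hmeas.stronglyMeasurable.integral_prod_right (ν := D)
    exact this.measurable
  have he : Measurable (fun p : (Fin n → Z) × (Fin d → ℝ) => e p.2 p.1) := by
    have : ∀ i : Fin n, Measurable (fun p : (Fin n → Z) × (Fin d → ℝ) => ℓ p.2 (p.1 i)) := by
      intro i
      exact hmeas.comp (measurable_snd.prodMk ((measurable_pi_apply i).comp measurable_fst))
    exact (Finset.measurable_sum _ fun i _ => this i).const_mul _
  have hℓθ : ∀ θ, Measurable (ℓ θ) := fun θ => hmeas.comp measurable_prodMk_left
  have hr01 : ∀ θ, r θ ∈ Set.Icc (0 : ℝ) 1 := by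
    intro θ
    refine ⟨integral_nonneg fun z => (hℓ θ z).1, ?_⟩
    have : r θ ≤ ∫ z, (1 : ℝ) ∂D :=
      integral_mono_of_nonneg (Filter.Eventually.of_forall fun z => (hℓ θ z).1)
        (integrable_const _) (Filter.Eventually.of_forall fun z => (hℓ θ z).2)
    simpa using this
  have he01 : ∀ θ S, e θ S ∈ Set.Icc (0 : ℝ) 1 := by
    intro θ S
    have h0 : 0 ≤ ∑ i, ℓ θ (S i) := Finset.sum_nonneg fun i _ => (hℓ θ (S i)).1
    have h1 : ∑ i, ℓ θ (S i) ≤ ∑ _i : Fin n, (1 : ℝ) :=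
      Finset.sum_le_sum fun i _ => (hℓ θ (S i)).2
    simp only [Finset.sum_const, Finset.card_univ, Fintype.card_fin, nsmul_eq_mul, mul_one] at h1
    refine ⟨by positivity, ?_⟩
    change (1 / (n : ℝ)) * _ ≤ 1
    rw [one_div_mul_eq_div, div_le_one (by linarith)]
    exact h1
  let F : (Fin n → Z) → ENNReal := fun S =>
    ∫⁻ θ, ENNReal.ofReal (Real.exp ((2 * n - 1) * (r θ - e θ S) ^ 2)) ∂P
  have hGm : Measurable (fun p : (Fin n → Z) × (Fin d → ℝ) =>
      ENNReal.ofReal (Real.exp ((2 * n - 1) * (r p.2 - e p.2 p.1) ^ 2))) := by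
    have := hr.comp (measurable_snd : Measurable (Prod.snd : (Fin n → Z) × (Fin d → ℝ) → _))
    exact (Real.measurable_exp.comp (((this.sub he).pow_const 2).const_mul _)).ennreal_ofReal
  have hF : Measurable F := hGm.lintegral_prod_right'
  have hFi : ∫⁻ S, F S ∂(Measure.pi fun _ : Fin n => D) ≤ ENNReal.ofReal (2 * n) := by
    simp only [F]
    rw [lintegral_lintegral_swap hGm.aemeasurable]
    calc _ ≤ ∫⁻ _θ, ENNReal.ofReal (2 * n) ∂P :=
          lintegral_mono fun θ => aux_mgf hn D (ℓ θ) (hℓθ θ) (hℓ θ)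
      _ = _ := by simp
  set c : ℝ := 2 * n / δ with hc
  have hcpos : 0 < c := by positivity
  have hbad : (Measure.pi fun _ : Fin n => D) {S | ENNReal.ofReal c ≤ F S}
      ≤ ENNReal.ofReal δ := by
    refine (meas_ge_le_lintegral_div hF.aemeasurable (by simpa using hcpos)
      ENNReal.ofReal_ne_top).trans ?_
    refine (ENNReal.div_le_div_right hFi _).trans ?_
    rw [← ENNReal.ofReal_div_of_pos hcpos]
    apply ENNReal.ofReal_le_ofReal
    rw [hc, div_div_eq_mul_div, mul_div_cancel_left₀ _ (by positivity)]
  have hms : MeasurableSet {S | ENNReal.ofReal c ≤ F S} := measurableSet_le measurable_const hF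
  calc 1 - ENNReal.ofReal δ
      ≤ 1 - (Measure.pi fun _ : Fin n => D) {S | ENNReal.ofReal c ≤ F S} :=
        tsub_le_tsub_left hbad 1
    _ = (Measure.pi fun _ : Fin n => D) {S | ENNReal.ofReal c ≤ F S}ᶜ :=
        (prob_compl_eq_one_sub hms).symm
    _ ≤ _ := measure_mono ?_
  intro S hS μ σ Δμ Δσ _ hpos
  simp only [Set.mem_compl_iff, Set.mem_setOf_eq, not_le] at hS
  obtain ⟨w, hw, hwi, hPw, hkl⟩ := aux_diag (fun k => μ k - Δμ k) (fun k => σ k - Δσ k) hpos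
  have hnorm := aux_norm μ σ Δμ Δσ
  set Q := diagGaussian (fun k => μ k - Δμ k) (fun k => σ k - Δσ k) with hQ
  have hQp : IsProbabilityMeasure Q := by
    rw [hQ]; unfold diagGaussian; infer_instance
  have heS : Measurable (fun θ => e θ S) := he.comp measurable_prodMk_left
  have hri : Integrable r Q := Integrable.of_mem_Icc 0 1 hr.aemeasurable
    (Filter.Eventually.of_forall hr01)
  have hei : Integrable (fun θ => e θ S) Q := Integrable.of_mem_Icc 0 1 heS.aemeasurable
    (Filter.Eventually.of_forall fun θ => he01 θ S)
  have hg2 : Integrable (fun θ => (r θ - e θ S) ^ 2) Q := by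
    refine Integrable.of_mem_Icc 0 1 ((hr.sub heS).pow_const 2).aemeasurable
      (Filter.Eventually.of_forall fun θ => ⟨sq_nonneg _, ?_⟩)
    have h1 := hr01 θ
    have h2 := he01 θ S
    simp only [Set.mem_Icc] at h1 h2
    rw [sq_le_one_iff_abs_le_one, abs_le]
    constructor <;> linarith
  have hdv := aux_dv P Q w (fun θ => (2 * n - 1) * (r θ - e θ S) ^ 2) hw
    (((hr.sub heS).pow_const 2).const_mul _) hPw hwi (hg2.const_mul _) c hcpos hS.le
  have hj := (even_two.convexOn_pow (𝕜 := ℝ)).map_integral_le (μ := Q)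
    (f := fun θ => r θ - e θ S) (continuous_pow 2).continuousOn isClosed_univ
    (Filter.Eventually.of_forall fun x => Set.mem_univ _) (hri.sub hei) hg2
  rw [integral_sub hri hei] at hj
  rw [integral_const_mul, hkl] at hdv
  have hRe : expRisk D ℓ Q = ∫ θ, r θ ∂Q := rfl
  have hEe : empRisk ℓ Q S = ∫ θ, e θ S ∂Q := rfl
  rw [hRe, hEe, ← sub_le_iff_le_add']
  apply Real.le_sqrt_of_sq_le
  rw [le_div_iff₀ (by linarith)]
  have hlog : Real.log c = Real.log 2 + Real.log n + Real.log (1 / δ) := by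
    rw [hc, ← Real.log_mul (by norm_num) (by positivity), ← Real.log_mul (by positivity)
      (by positivity), mul_one_div]
  have hlog2 : Real.log 2 ≤ 2 := by
    have := Real.log_two_lt_d9
    linarith
  have hmul := mul_le_mul_of_nonneg_left hj (by linarith : (0 : ℝ) ≤ 2 * n - 1)
  rw [hlog] at hdv
  linarith
end
end
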